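/- Let η, η′ > 0 and let A, B, C ⊆ ℝ be Lebesgue measurable sets with finite, positive Lebesgue measures satisfying |A| > η + η′, |B| > η + η′, and |C| ≤ |A| + |B|. Let D ≥ 0 and suppose ⟨1_A∗1_B, 1_C⟩ = ⟨1_{A⋆}∗1_{B⋆}, 1_{C⋆}⟩ − D. Then ⟨1_{A_{η,η′}}∗1_{B_{η′,η}}, 1_C⟩ ≥ ⟨1_{(A_{η,η′})⋆}∗1_{(B_{η′,η})⋆}, 1_{C⋆}⟩ − D; that is, the Riesz–Sobolev deficit does not increase under this pair of truncations: D(A_{η,η′}, B_{η′,η}, C) ≤ D(A,B,C). -/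

import Mathlib

open MeasureTheory Set Pointwise

/-- Lebesgue measure of a set of reals, as a real number. -/
noncomputable def lm (S : Set ℝ) : ℝ := (MeasureTheory.volume S).toReal

/-- Convolution of indicator functions: `(1_A ∗ 1_B)(x) = ∫ 1_A(y) 1_B(x−y) dy`. -/
noncomputable def cv (A B : Set ℝ) (x : ℝ) : ℝ :=
  ∫ y, A.indicator (1 : ℝ → ℝ) y * B.indicator (1 : ℝ → ℝ) (x - y)

/-- The pairing `⟨1_A ∗ 1_B, 1_C⟩ = ∫ (1_A ∗ 1_B) · 1_C`. -/
noncomputable def pr (A B C : Set ℝ) : ℝ := ∫ x, cv A B x * C.indicator (1 : ℝ → ℝ) x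

/-- The symmetric rearrangement `S⋆`: the open interval centered at 0 with `|S⋆| = |S|`. -/
noncomputable def sstar (S : Set ℝ) : Set ℝ := Set.Ioo (-(lm S / 2)) (lm S / 2)

/-- The Riesz–Sobolev deficit `D(A,B,C) = ⟨1_{A⋆}∗1_{B⋆},1_{C⋆}⟩ − ⟨1_A∗1_B,1_C⟩`. -/
noncomputable def rsD (A B C : Set ℝ) : ℝ := pr (sstar A) (sstar B) (sstar C) - pr A B C

/-- The superlevel set `S_{A,B}(t) = {x : (1_A ∗ 1_B)(x) > t}`. -/
def slev (A B : Set ℝ) (t : ℝ) : Set ℝ := {x | cv A B x > t}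

/-- The KPRGT deficit `D′(A,B,τ) = (|A|−τ)(|B|−τ) − ∫_τ^∞ |S_{A,B}(t)| dt`. -/
noncomputable def kD (A B : Set ℝ) (τ : ℝ) : ℝ :=
  (lm A - τ) * (lm B - τ) - ∫ t in Set.Ioi τ, lm (slev A B t)

/-- `η`-strict admissibility of the ordered triple `(A,B,C)`:
`|X| + |Y| ≥ |Z| + η·max(|A|,|B|,|C|)` for every permutation `(X,Y,Z)` of `(A,B,C)`. -/
def adm (η : ℝ) (A B C : Set ℝ) : Prop :=
  lm A + lm B ≥ lm C + η * max (lm A) (max (lm B) (lm C)) ∧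
  lm A + lm C ≥ lm B + η * max (lm A) (max (lm B) (lm C)) ∧
  lm B + lm C ≥ lm A + η * max (lm A) (max (lm B) (lm C))

/-- The truncation `S_{η,η′} = S ∩ [a,b]`, where `a` is the smallest real with
`|S ∩ (−∞,a)| = η` (no lower truncation when `η = 0`) and `b` is the largest real
with `|S ∩ (b,∞)| = η′` (no upper truncation when `η′ = 0`). -/
noncomputable def trunc (S : Set ℝ) (η ηp : ℝ) : Set ℝ :=
  S ∩ (if η = 0 then Set.univ
        else Set.Ici (sInf {a : ℝ | lm (S ∩ Set.Iio a) = η}))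
    ∩ (if ηp = 0 then Set.univ
        else Set.Iic (sSup {b : ℝ | lm (S ∩ Set.Ioi b) = ηp}))


lemma lm_mono {S T : Set ℝ} (h : S ⊆ T) (hT : volume T ≠ ⊤) : lm S ≤ lm T :=
  ENNReal.toReal_mono hT (measure_mono h)

lemma lm_nonneg (S : Set ℝ) : 0 ≤ lm S := ENNReal.toReal_nonneg

lemma lm_Ioo {r s : ℝ} : lm (Ioo r s) = max 0 (s - r) := by
  simp [lm, ENNReal.toReal_ofReal', max_comm]

lemma lm_diff {S T : Set ℝ} (hT : MeasurableSet T) (h : T ⊆ S) (hS : volume S ≠ ⊤) :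
    lm (S \ T) = lm S - lm T := measureReal_sdiff h hT hS

lemma integrable_indicator_one {S : Set ℝ} (hS : MeasurableSet S) (hSf : volume S ≠ ⊤) :
    Integrable (S.indicator (1 : ℝ → ℝ)) :=
  (integrableOn_const hSf).integrable_indicator hS

lemma integral_indicator_one_eq_lm {S : Set ℝ} (hS : MeasurableSet S) :
    ∫ x, S.indicator (1 : ℝ → ℝ) x = lm S := integral_indicator_one hS

lemma cv_eq_lm {A B : Set ℝ} (hA : MeasurableSet A) (hB : MeasurableSet B) (x : ℝ) :
    cv A B x = lm (A ∩ (fun y => x - y) ⁻¹' B) := by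
  rw [← integral_indicator_one_eq_lm (hA.inter (hB.preimage (by fun_prop))), cv]
  congr 1 with y
  simp only [indicator, mem_inter_iff, mem_preimage, Pi.one_apply]
  split_ifs <;> simp_all

lemma integrable_cv {A B : Set ℝ} (hA : MeasurableSet A) (hB : MeasurableSet B)
    (hAf : volume A ≠ ⊤) (hBf : volume B ≠ ⊤) : Integrable (cv A B) :=
  (integrable_indicator_one hA hAf).integrable_convolution (ContinuousLinearMap.mul ℝ ℝ)
    (integrable_indicator_one hB hBf)

lemma integral_cv {A B : Set ℝ} (hA : MeasurableSet A) (hB : MeasurableSet B)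
    (hAf : volume A ≠ ⊤) (hBf : volume B ≠ ⊤) : ∫ x, cv A B x = lm A * lm B := by
  rw [← integral_indicator_one_eq_lm hA, ← integral_indicator_one_eq_lm hB]
  exact integral_convolution (ContinuousLinearMap.mul ℝ ℝ)
    (integrable_indicator_one hA hAf) (integrable_indicator_one hB hBf)

lemma pr_eq_setIntegral (A B : Set ℝ) {C : Set ℝ} (hC : MeasurableSet C) :
    pr A B C = ∫ x in C, cv A B x := by
  rw [pr, ← integral_indicator hC]
  congr 1 with x
  by_cases h : x ∈ C <;> simp [h]

lemma cv_mono {A A' B B' : Set ℝ} (hA : MeasurableSet A) (hB : MeasurableSet B)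
    (hA' : MeasurableSet A') (hB' : MeasurableSet B') (hAf : volume A ≠ ⊤)
    (hAA : A' ⊆ A) (hBB : B' ⊆ B) (x : ℝ) : cv A' B' x ≤ cv A B x := by
  rw [cv_eq_lm hA hB, cv_eq_lm hA' hB']
  exact lm_mono (inter_subset_inter hAA (preimage_mono hBB))
    (measure_ne_top_of_subset inter_subset_left hAf)

lemma pr_sub_pr_le {A A' B B' C : Set ℝ} (hA : MeasurableSet A) (hB : MeasurableSet B)
    (hA' : MeasurableSet A') (hB' : MeasurableSet B') (hC : MeasurableSet C)
    (hAf : volume A ≠ ⊤) (hBf : volume B ≠ ⊤) (hAA : A' ⊆ A) (hBB : B' ⊆ B) :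
    pr A B C - pr A' B' C ≤ lm A * lm B - lm A' * lm B' := by
  have hAf' := measure_ne_top_of_subset hAA hAf
  have hBf' := measure_ne_top_of_subset hBB hBf
  have h := integrable_cv hA hB hAf hBf
  have h' := integrable_cv hA' hB' hAf' hBf'
  rw [pr_eq_setIntegral _ _ hC, pr_eq_setIntegral _ _ hC, ← integral_cv hA hB hAf hBf,
    ← integral_cv hA' hB' hAf' hBf', ← integral_sub h.integrableOn h'.integrableOn,
    ← integral_sub h h']
  exact setIntegral_le_integral (h.sub h')
    (ae_of_all _ fun x => sub_nonneg.2 (cv_mono hA hB hA' hB' hAf hAA hBB x))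

lemma pr_le_mul {A B C : Set ℝ} (hA : MeasurableSet A) (hB : MeasurableSet B)
    (hC : MeasurableSet C) (hAf : volume A ≠ ⊤) (hBf : volume B ≠ ⊤) :
    pr A B C ≤ lm A * lm B := by
  rw [pr_eq_setIntegral _ _ hC, ← integral_cv hA hB hAf hBf]
  refine setIntegral_le_integral (integrable_cv hA hB hAf hBf) (ae_of_all _ fun x => ?_)
  simp only [cv_eq_lm hA hB]
  exact lm_nonneg _

/-- Cutting mass `s` from the left of `A` and the right of `B`, and mass `t` from the right of `A`
and the left of `B`, decreases the convolution by at most `s + t` at every point. -/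
lemma cv_sub_cv_inter_Icc_le {A B : Set ℝ} (hA : MeasurableSet A) (hB : MeasurableSet B)
    (hAf : volume A ≠ ⊤) (hBf : volume B ≠ ⊤) {p q u v s t : ℝ}
    (hp : lm (A ∩ Iio p) ≤ s) (hq : lm (A ∩ Ioi q) ≤ t)
    (hu : lm (B ∩ Iio u) ≤ t) (hv : lm (B ∩ Ioi v) ≤ s) (x : ℝ) :
    cv A B x - cv (A ∩ Icc p q) (B ∩ Icc u v) x ≤ s + t := by
  have reflect : ∀ T : Set ℝ, MeasurableSet T → lm ((fun y => x - y) ⁻¹' T) = lm T := by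
    intro T hT
    unfold lm
    rw [(Measure.measurePreserving_sub_left volume x).measure_preimage hT.nullMeasurableSet]
  have hr : Measurable fun y : ℝ => x - y := by fun_prop
  have hBr : volume ((fun y => x - y) ⁻¹' B) ≠ ⊤ := by
    rwa [(Measure.measurePreserving_sub_left volume x).measure_preimage hB.nullMeasurableSet]
  have hA' : MeasurableSet (A ∩ Icc p q) := hA.inter measurableSet_Icc
  have hB' : MeasurableSet (B ∩ Icc u v) := hB.inter measurableSet_Icc
  rw [cv_eq_lm hA hB, cv_eq_lm hA' hB', ← lm_diff (hA'.inter (hr hB'))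
    (inter_subset_inter inter_subset_left (preimage_mono inter_subset_left))
    (measure_ne_top_of_subset inter_subset_left hAf)]
  set E := A ∩ (fun y => x - y) ⁻¹' B
  have hEA : E ⊆ A := inter_subset_left
  have hEB : E ⊆ (fun y => x - y) ⁻¹' B := inter_subset_right
  have hEf : volume E ≠ ⊤ := measure_ne_top_of_subset hEA hAf
  have hL : lm (E ∩ Iio (max p (x - v))) ≤ s := by
    rcases le_total (x - v) p with h | h
    · rw [max_eq_left h]
      exact (lm_mono (inter_subset_inter_left _ hEA)
        (measure_ne_top_of_subset inter_subset_left hAf)).trans hp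
    · rw [max_eq_right h]
      refine (lm_mono (T := (fun y => x - y) ⁻¹' (B ∩ Ioi v)) ?_
        (measure_ne_top_of_subset (preimage_mono inter_subset_left) hBr)).trans
        ((reflect _ (hB.inter measurableSet_Ioi)).trans_le hv)
      rintro y ⟨hy, hy'⟩
      simp only [mem_Iio] at hy'
      exact ⟨hEB hy, show v < x - y by linarith⟩
  have hR : lm (E ∩ Ioi (min q (x - u))) ≤ t := by
    rcases le_total q (x - u) with h | h
    · rw [min_eq_left h]
      exact (lm_mono (inter_subset_inter_left _ hEA)
        (measure_ne_top_of_subset inter_subset_left hAf)).trans hq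
    · rw [min_eq_right h]
      refine (lm_mono (T := (fun y => x - y) ⁻¹' (B ∩ Iio u)) ?_
        (measure_ne_top_of_subset (preimage_mono inter_subset_left) hBr)).trans
        ((reflect _ (hB.inter measurableSet_Iio)).trans_le hu)
      rintro y ⟨hy, hy'⟩
      simp only [mem_Ioi] at hy'
      exact ⟨hEB hy, show x - y < u by linarith⟩
  have hsub : E \ (A ∩ Icc p q ∩ (fun y => x - y) ⁻¹' (B ∩ Icc u v)) ⊆
      E ∩ Iio (max p (x - v)) ∪ E ∩ Ioi (min q (x - u)) := by
    rintro y ⟨hy, hy'⟩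
    by_contra! h
    simp only [mem_union, mem_inter_iff, mem_Iio, mem_Ioi, hy, true_and, not_or, not_lt,
      max_le_iff, le_min_iff] at h
    exact hy' ⟨⟨hEA hy, h.1.1, h.2.1⟩, hEB hy, show u ≤ x - y by linarith,
      show x - y ≤ v by linarith⟩
  calc lm (E \ _) ≤ lm (E ∩ Iio (max p (x - v)) ∪ E ∩ Ioi (min q (x - u))) :=
        lm_mono hsub (measure_ne_top_of_subset
          (union_subset inter_subset_left inter_subset_left) hEf)
    _ ≤ lm (E ∩ Iio (max p (x - v))) + lm (E ∩ Ioi (min q (x - u))) :=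
        measureReal_union_le _ _
    _ ≤ s + t := add_le_add hL hR

lemma pr_sub_pr_inter_Icc_le {A B C : Set ℝ} (hA : MeasurableSet A) (hB : MeasurableSet B)
    (hC : MeasurableSet C) (hAf : volume A ≠ ⊤) (hBf : volume B ≠ ⊤) (hCf : volume C ≠ ⊤)
    {p q u v s t : ℝ} (hp : lm (A ∩ Iio p) ≤ s) (hq : lm (A ∩ Ioi q) ≤ t)
    (hu : lm (B ∩ Iio u) ≤ t) (hv : lm (B ∩ Ioi v) ≤ s) :
    pr A B C - pr (A ∩ Icc p q) (B ∩ Icc u v) C ≤ (s + t) * lm C := by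
  have h := integrable_cv hA hB hAf hBf
  have h' := integrable_cv (hA.inter (measurableSet_Icc (a := p) (b := q)))
    (hB.inter (measurableSet_Icc (a := u) (b := v)))
    (measure_ne_top_of_subset inter_subset_left hAf)
    (measure_ne_top_of_subset inter_subset_left hBf)
  rw [pr_eq_setIntegral _ _ hC, pr_eq_setIntegral _ _ hC,
    ← integral_sub h.integrableOn h'.integrableOn]
  calc _ ≤ ∫ x in C, (s + t) := setIntegral_mono (h.sub h').integrableOn (integrableOn_const hCf)
        fun x => cv_sub_cv_inter_Icc_le hA hB hAf hBf hp hq hu hv x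
    _ = (s + t) * lm C := by simp [lm, measureReal_def, mul_comm]

/-- The open interval of length `r` centered at the origin. -/
def centeredIoo (r : ℝ) : Set ℝ := Ioo (-(r / 2)) (r / 2)

lemma measurableSet_centeredIoo (r : ℝ) : MeasurableSet (centeredIoo r) := measurableSet_Ioo

lemma volume_centeredIoo_ne_top (r : ℝ) : volume (centeredIoo r) ≠ ⊤ := measure_Ioo_lt_top.ne

lemma lm_centeredIoo {r : ℝ} (hr : 0 ≤ r) : lm (centeredIoo r) = r := by
  rw [centeredIoo, lm_Ioo, max_eq_right] <;> linarith

lemma cv_centeredIoo (a b x : ℝ) : cv (centeredIoo a) (centeredIoo b) x =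
    max 0 (min (a / 2) (x + b / 2) - max (-(a / 2)) (x - b / 2)) := by
  rw [cv_eq_lm (measurableSet_centeredIoo a) (measurableSet_centeredIoo b), ← lm_Ioo]
  congr 1
  ext y
  simp only [centeredIoo, mem_inter_iff, mem_Ioo, mem_preimage, max_lt_iff, lt_min_iff]
  constructor <;> rintro ⟨⟨_, _⟩, _, _⟩ <;> refine ⟨⟨?_, ?_⟩, ?_, ?_⟩ <;> linarith

lemma pr_centeredIoo_of_add_le {a b c : ℝ} (ha : 0 ≤ a) (hb : 0 ≤ b) (h : a + b ≤ c) :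
    pr (centeredIoo a) (centeredIoo b) (centeredIoo c) = a * b := by
  conv_rhs => rw [← lm_centeredIoo ha, ← lm_centeredIoo hb]
  rw [← integral_cv (measurableSet_centeredIoo a) (measurableSet_centeredIoo b)
    (volume_centeredIoo_ne_top a) (volume_centeredIoo_ne_top b), pr]
  congr 1 with x
  by_cases hx : x ∈ centeredIoo c
  · simp [hx]
  · have : cv (centeredIoo a) (centeredIoo b) x = 0 := by
      rw [cv_centeredIoo, max_eq_left]
      have : x ≤ -(c / 2) ∨ c / 2 ≤ x := by
        by_contra! h
        exact hx h
      rcases this with h | h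
      · linarith [min_le_right (a / 2) (x + b / 2), le_max_left (-(a / 2)) (x - b / 2)]
      · linarith [min_le_left (a / 2) (x + b / 2), le_max_right (-(a / 2)) (x - b / 2)]
    simp [this]

lemma mul_le_pr_centeredIoo_sub {a b c s : ℝ} (hc : 0 ≤ c) (ha : s ≤ a) (hb : s ≤ b)
    (h : c ≤ a + b - 2 * s) :
    s * c ≤ pr (centeredIoo a) (centeredIoo b) (centeredIoo c) -
      pr (centeredIoo (a - s)) (centeredIoo (b - s)) (centeredIoo c) := by
  have hi : ∀ a b, Integrable (cv (centeredIoo a) (centeredIoo b)) := fun a b =>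
    integrable_cv (measurableSet_centeredIoo a) (measurableSet_centeredIoo b)
    (volume_centeredIoo_ne_top a) (volume_centeredIoo_ne_top b)
  have hC := measurableSet_centeredIoo c
  rw [pr_eq_setIntegral _ _ hC, pr_eq_setIntegral _ _ hC,
    ← integral_sub (hi _ _).integrableOn (hi _ _).integrableOn]
  calc s * c = ∫ x in centeredIoo c, s := by
        rw [setIntegral_const, smul_eq_mul, mul_comm]
        congr 1
        exact (lm_centeredIoo hc).symm
    _ ≤ _ := by
      refine setIntegral_mono_on (integrableOn_const (volume_centeredIoo_ne_top c))
        ((hi _ _).sub (hi _ _)).integrableOn hC fun x hx => ?_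
      rw [cv_centeredIoo, cv_centeredIoo]
      obtain ⟨h1, h2⟩ := hx
      have : 0 ≤ min ((a - s) / 2) (x + (b - s) / 2) - max (-((a - s) / 2)) (x - (b - s) / 2) := by
        rw [sub_nonneg, le_min_iff, max_le_iff, max_le_iff]
        refine ⟨⟨?_, ?_⟩, ?_, ?_⟩ <;> linarith
      rw [max_eq_right this]
      have e1 : min ((a - s) / 2) (x + (b - s) / 2) = min (a / 2) (x + b / 2) - s / 2 := by
        rw [← min_sub_sub_right]; congr 1 <;> ring
      have e2 : max (-((a - s) / 2)) (x - (b - s) / 2) = max (-(a / 2)) (x - b / 2) + s / 2 := by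
        rw [← max_add_add_right]; congr 1 <;> ring
      rw [e1, e2]
      linarith [le_max_right 0 (min (a / 2) (x + b / 2) - max (-(a / 2)) (x - b / 2))]

lemma lm_inter_Ioi {S : Set ℝ} (hSf : volume S ≠ ⊤) (t : ℝ) :
    lm (S ∩ Ioi t) = lm S - lm (S ∩ Iio t) := by
  have h1 : lm (S ∩ Iio t) = lm (S ∩ Iic t) := by
    unfold lm
    rw [measure_congr (ae_eq_refl S |>.inter (Iio_ae_eq_Iic (μ := volume) (a := t)))]
  have h2 : lm (S ∩ Iic t) + lm (S \ Iic t) = lm S :=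
    measureReal_inter_add_sdiff measurableSet_Iic hSf
  rw [sdiff_eq, compl_Iic] at h2
  linarith

lemma monotone_lm_inter_Iio {S : Set ℝ} (hSf : volume S ≠ ⊤) :
    Monotone fun t => lm (S ∩ Iio t) := fun _ _ h =>
  lm_mono (inter_subset_inter_right _ (Iio_subset_Iio h))
    (measure_ne_top_of_subset inter_subset_left hSf)

lemma continuous_lm_inter_Iio {S : Set ℝ} (hSf : volume S ≠ ⊤) :
    Continuous fun t => lm (S ∩ Iio t) := by
  refine (LipschitzWith.of_le_add fun x y => ?_).continuous
  have : S ∩ Iio x ⊆ S ∩ Iio y ∪ Ico y x := by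
    rintro z ⟨hz, hzx⟩
    rcases lt_or_ge z y with h | h
    · exact Or.inl ⟨hz, h⟩
    · exact Or.inr ⟨h, hzx⟩
  calc lm (S ∩ Iio x) ≤ lm (S ∩ Iio y ∪ Ico y x) := lm_mono this (measure_union_lt_top
        (measure_ne_top_of_subset inter_subset_left hSf).lt_top measure_Ico_lt_top).ne
    _ ≤ lm (S ∩ Iio y) + lm (Ico y x) := measureReal_union_le _ _
    _ ≤ lm (S ∩ Iio y) + dist x y := by
      gcongr
      rw [lm, Real.volume_Ico, ENNReal.toReal_ofReal', Real.dist_eq]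
      exact max_le (le_abs_self _) (abs_nonneg _)

lemma tendsto_lm_inter_Iio_atTop {S : Set ℝ} (hSf : volume S ≠ ⊤) :
    Filter.Tendsto (fun t => lm (S ∩ Iio t)) Filter.atTop (nhds (lm S)) := by
  have h := tendsto_measure_iUnion_atTop (μ := volume) (s := fun t : ℝ => S ∩ Iio t)
    fun _ _ h => inter_subset_inter_right _ (Iio_subset_Iio h)
  rw [← inter_iUnion, iUnion_Iio, inter_univ] at h
  exact (ENNReal.tendsto_toReal hSf).comp h

lemma tendsto_lm_inter_Iio_atBot {S : Set ℝ} (hS : MeasurableSet S) (hSf : volume S ≠ ⊤) :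
    Filter.Tendsto (fun t => lm (S ∩ Iio t)) Filter.atBot (nhds 0) := by
  have h := tendsto_measure_iInter_atBot (μ := volume) (s := fun t : ℝ => S ∩ Iio t)
    (fun t => (hS.inter measurableSet_Iio).nullMeasurableSet)
    (fun _ _ h => inter_subset_inter_right _ (Iio_subset_Iio h))
    ⟨0, measure_ne_top_of_subset inter_subset_left hSf⟩
  have h0 : ⋂ t : ℝ, Iio t = ∅ :=
    eq_empty_of_forall_notMem fun x hx => lt_irrefl x (mem_iInter.1 hx x)
  rw [← inter_iInter, h0, inter_empty, measure_empty] at h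
  exact (ENNReal.tendsto_toReal ENNReal.zero_ne_top).comp h

lemma level_lm_inter_Iio {S : Set ℝ} (hS : MeasurableSet S) (hSf : volume S ≠ ⊤) {m : ℝ}
    (h0 : 0 < m) (h1 : m < lm S) :
    {t | lm (S ∩ Iio t) = m}.Nonempty ∧ BddBelow {t | lm (S ∩ Iio t) = m} ∧
      BddAbove {t | lm (S ∩ Iio t) = m} ∧ IsClosed {t | lm (S ∩ Iio t) = m} := by
  have hmono := monotone_lm_inter_Iio hSf
  obtain ⟨x, hx⟩ := ((tendsto_lm_inter_Iio_atBot hS hSf).eventually_lt_const h0).exists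
  obtain ⟨y, hy⟩ := ((tendsto_lm_inter_Iio_atTop hSf).eventually_const_lt h1).exists
  refine ⟨?_, ⟨x, fun t ht => ?_⟩, ⟨y, fun t ht => ?_⟩,
    isClosed_eq (continuous_lm_inter_Iio hSf) continuous_const⟩
  · exact mem_range_of_exists_le_of_exists_ge (continuous_lm_inter_Iio hSf) ⟨x, hx.le⟩ ⟨y, hy.le⟩
  · by_contra! h
    have := hmono h.le
    simp only [mem_ofPred_eq] at ht this
    linarith
  · by_contra! h
    have := hmono h.le
    simp only [mem_ofPred_eq] at ht this
    linarith

lemma exists_trunc_eq {S : Set ℝ} (hS : MeasurableSet S) (hSf : volume S ≠ ⊤) {s t : ℝ}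
    (hs : 0 < s) (ht : 0 < t) (hst : s + t < lm S) :
    ∃ p q, trunc S s t = S ∩ Icc p q ∧ lm (S ∩ Iio p) = s ∧ lm (S ∩ Ioi q) = t := by
  obtain ⟨n1, b1, -, c1⟩ := level_lm_inter_Iio hS hSf hs (by linarith)
  obtain ⟨n2, -, b2, c2⟩ := level_lm_inter_Iio hS hSf (m := lm S - t) (by linarith) (by linarith)
  have e : {b : ℝ | lm (S ∩ Ioi b) = t} = {b | lm (S ∩ Iio b) = lm S - t} := by
    ext b
    rw [mem_ofPred_eq, mem_ofPred_eq, lm_inter_Ioi hSf]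
    constructor <;> intro h <;> linarith
  refine ⟨_, _, ?_, c1.csInf_mem n1 b1, e ▸ c2.csSup_mem n2 b2⟩
  rw [trunc, if_neg hs.ne', if_neg ht.ne', inter_assoc, Ici_inter_Iic, e]

lemma lm_inter_Icc {S : Set ℝ} (hS : MeasurableSet S) (hSf : volume S ≠ ⊤) {p q s t : ℝ}
    (hp : lm (S ∩ Iio p) = s) (hq : lm (S ∩ Ioi q) = t) (hst : s + t < lm S) :
    lm (S ∩ Icc p q) = lm S - (s + t) := by
  have hf : ∀ T, volume (S ∩ T) ≠ ⊤ := fun T => measure_ne_top_of_subset inter_subset_left hSf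
  have hpq : p ≤ q := by
    by_contra! h
    have := monotone_lm_inter_Iio hSf h.le
    have := lm_inter_Ioi hSf q
    simp only at *
    linarith
  have h1 : S ∩ Icc p q = S \ (S ∩ Iio p ∪ S ∩ Ioi q) := by
    ext x
    simp only [mem_inter_iff, mem_Icc, mem_sdiff, mem_union, mem_Iio, mem_Ioi]
    grind
  have h2 : lm (S ∩ Iio p ∪ S ∩ Ioi q) = lm (S ∩ Iio p) + lm (S ∩ Ioi q) := by
    refine measureReal_union ?_ (hS.inter measurableSet_Ioi) (hf _) (hf _)
    rw [disjoint_left]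
    rintro x ⟨_, hx⟩ ⟨_, hx'⟩
    simp only [mem_Iio, mem_Ioi] at hx hx'
    linarith
  rw [h1, lm_diff ((hS.inter measurableSet_Iio).union (hS.inter measurableSet_Ioi))
    (union_subset inter_subset_left inter_subset_left) hSf, h2, hp, hq]

lemma Icc_subset_Icc_of_lm_lt {S : Set ℝ} (hSf : volume S ≠ ⊤) {p q p' q' : ℝ}
    (hp : lm (S ∩ Iio p') < lm (S ∩ Iio p)) (hq : lm (S ∩ Ioi q') < lm (S ∩ Ioi q)) :
    Icc p q ⊆ Icc p' q' := by
  refine Icc_subset_Icc ((monotone_lm_inter_Iio hSf).reflect_lt hp).le ?_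
  rw [lm_inter_Ioi hSf, lm_inter_Ioi hSf] at hq
  exact ((monotone_lm_inter_Iio hSf).reflect_lt (by linarith)).le

/-- The Riesz–Sobolev deficit does not increase under the pair of truncations
`A ↦ A_{η,η′}`, `B ↦ B_{η′,η}`. -/
theorem truncation_deficit_monotone (η η' : ℝ) (hη : 0 < η) (hη' : 0 < η')
    (A B C : Set ℝ)
    (hA : MeasurableSet A) (hB : MeasurableSet B) (hC : MeasurableSet C)
    (hA0 : 0 < volume A) (hAf : volume A ≠ ⊤)
    (hB0 : 0 < volume B) (hBf : volume B ≠ ⊤)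
    (hC0 : 0 < volume C) (hCf : volume C ≠ ⊤)
    (hAbig : lm A > η + η') (hBbig : lm B > η + η')
    (hCsmall : lm C ≤ lm A + lm B)
    (D : ℝ) (hD0 : 0 ≤ D)
    (hD : pr A B C = pr (sstar A) (sstar B) (sstar C) - D) :
    pr (trunc A η η') (trunc B η' η) C
      ≥ pr (sstar (trunc A η η')) (sstar (trunc B η' η)) (sstar C) - D := by
  have star : ∀ S, sstar S = centeredIoo (lm S) := fun _ => rfl
  obtain ⟨p, q, hA', hp, hq⟩ := exists_trunc_eq hA hAf hη hη' hAbig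
  obtain ⟨u, v, hB', hu, hv⟩ := exists_trunc_eq hB hBf hη' hη (by linarith)
  have hlA := lm_inter_Icc hA hAf hp hq hAbig
  have hlB := lm_inter_Icc hB hBf hu hv (by linarith)
  rw [add_comm η' η] at hlB
  rw [hA', hB', star, star, star, hlA, hlB]
  rw [star, star, star] at hD
  have hc := lm_nonneg C
  have hmA : MeasurableSet (A ∩ Icc p q) := hA.inter measurableSet_Icc
  have hmB : MeasurableSet (B ∩ Icc u v) := hB.inter measurableSet_Icc
  rcases le_or_gt (lm C) (lm A + lm B - 2 * (η + η')) with h | h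
  · have h1 := pr_sub_pr_inter_Icc_le hA hB hC hAf hBf hCf hp.le hq.le hu.le hv.le
    have h2 := mul_le_pr_centeredIoo_sub hc hAbig.le hBbig.le h
    linarith
  have hstar : pr (centeredIoo (lm A - (η + η'))) (centeredIoo (lm B - (η + η')))
      (centeredIoo (lm C)) ≤ (lm A - (η + η')) * (lm B - (η + η')) := by
    have := pr_le_mul (measurableSet_centeredIoo (lm A - (η + η')))
      (measurableSet_centeredIoo (lm B - (η + η'))) (measurableSet_centeredIoo (lm C))
      (volume_centeredIoo_ne_top _) (volume_centeredIoo_ne_top _)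
    rwa [lm_centeredIoo (by linarith), lm_centeredIoo (by linarith)] at this
  rcases hCsmall.eq_or_lt with h0 | h0
  · have h1 := pr_sub_pr_le hA hB hmA hmB hC hAf hBf inter_subset_left inter_subset_left
    have h2 := pr_centeredIoo_of_add_le (lm_nonneg A) (lm_nonneg B) h0.ge
    rw [hlA, hlB] at h1
    linarith
  -- Cut less mass, in the same proportions, so that the centered intervals become tangent.
  obtain ⟨r, hr0, hr1, hr⟩ : ∃ r, 0 < r ∧ r < 1 ∧
      2 * (r * η + r * η') = lm A + lm B - lm C := by
    refine ⟨(lm A + lm B - lm C) / (2 * (η + η')), by apply div_pos <;> linarith, ?_, ?_⟩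
    · rw [div_lt_one (by linarith)]
      linarith
    · field_simp
  have hrη : r * η < η := mul_lt_of_lt_one_left hη hr1
  have hrη' : r * η' < η' := mul_lt_of_lt_one_left hη' hr1
  have hrp := mul_pos hr0 hη
  have hrp' := mul_pos hr0 hη'
  obtain ⟨p', q', -, hp', hq'⟩ := exists_trunc_eq hA hAf hrp hrp' (by linarith)
  obtain ⟨u', v', -, hu', hv'⟩ := exists_trunc_eq hB hBf hrp' hrp (by linarith)
  have hlA' := lm_inter_Icc hA hAf hp' hq' (by linarith)
  have hlB' := lm_inter_Icc hB hBf hu' hv' (by linarith)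
  rw [add_comm (r * η') (r * η)] at hlB'
  have h1 := pr_sub_pr_inter_Icc_le hA hB hC hAf hBf hCf hp'.le hq'.le hu'.le hv'.le
  have h2 := mul_le_pr_centeredIoo_sub (a := lm A) (b := lm B) (c := lm C) (s := r * η + r * η')
    hc (by linarith) (by linarith) (by linarith)
  have h3 := pr_sub_pr_le (hA.inter (measurableSet_Icc (a := p') (b := q')))
    (hB.inter (measurableSet_Icc (a := u') (b := v'))) hmA hmB hC
    (measure_ne_top_of_subset inter_subset_left hAf)
    (measure_ne_top_of_subset inter_subset_left hBf)
    (inter_subset_inter_right _ (Icc_subset_Icc_of_lm_lt hAf (by linarith) (by linarith)))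
    (inter_subset_inter_right _ (Icc_subset_Icc_of_lm_lt hBf (by linarith) (by linarith)))
  have h4 := pr_centeredIoo_of_add_le (a := lm A - (r * η + r * η'))
    (b := lm B - (r * η + r * η')) (c := lm C) (by linarith) (by linarith) (by linarith)
  rw [hlA, hlB, hlA', hlB'] at h3
  linarith
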